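/- arXiv:math-ph/0603041 — 2 statements merged into one kernel-verified Lean document; each statement's English description precedes it below -/
import Mathlib

section
/- Let g > 0 and define, for t ∈ ℝ, the classical fidelity F_C(t,g) := (1/π) ∫_{ℝ²} exp(-q² - p² + g²/((q·cos t + p·sin t)² + 2g²·sin²t/q²) - g²/q²) dq dp, where the integrand is taken to be 0 on the line q = 0. Then F_C(t,g) ≤ √2 · exp(-g·|sin t| / sqrt(1 + sin²t)) for every real t. -/
open MeasureTheory

lemma aux_glasser (a b : ℝ) (ha : 0 < a) (hb : 0 < b) :
    ∫ x in Set.Ioi (0:ℝ), Real.exp (-(a^2*x^2) - b^2/x^2)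
      = Real.sqrt Real.pi / (2*a) * Real.exp (-(2*a*b)) := by
  have hab : 0 < a * b := mul_pos ha hb
  have hpos : ∀ u : ℝ, 0 < u^2 + 4*(a*b) := fun u => by positivity
  have hsq : ∀ u : ℝ, Real.sqrt (u^2 + 4*(a*b)) ^ 2 = u^2 + 4*(a*b) :=
    fun u => Real.sq_sqrt (hpos u).le
  have hsp : ∀ u : ℝ, 0 < Real.sqrt (u^2 + 4*(a*b)) := fun u => Real.sqrt_pos.2 (hpos u)
  have habs : ∀ u : ℝ, |u| < Real.sqrt (u^2 + 4*(a*b)) := by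
    intro u
    apply Real.lt_sqrt_of_sq_lt
    rw [sq_abs]; linarith
  set φ : ℝ → ℝ := fun u => (u + Real.sqrt (u^2 + 4*(a*b))) / (2*a) with hφ
  have hφpos : ∀ u, 0 < φ u := by
    intro u
    have h1 := habs u
    have h2 := neg_abs_le u
    simp only [hφ]
    apply div_pos <;> linarith
  have hφeq : ∀ u, a * φ u ^ 2 - u * φ u - b = 0 := by
    intro u
    have h := hsq u
    simp only [hφ]
    generalize Real.sqrt (u^2 + 4*(a*b)) = r at h
    field_simp
    nlinarith
  have hφu : ∀ u, a * φ u - b / φ u = u := by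
    intro u
    have h := hφeq u
    have h0 := (hφpos u).ne'
    field_simp
    linarith
  have himg : Set.image φ Set.univ = Set.Ioi 0 := by
    ext x
    constructor
    · rintro ⟨u, -, rfl⟩; exact hφpos u
    · intro hx
      have hx : 0 < x := hx
      refine ⟨a*x - b/x, trivial, ?_⟩
      have : (a*x - b/x)^2 + 4*(a*b) = (a*x+b/x)^2 := by
        field_simp; ring
      simp only [hφ]
      rw [this, Real.sqrt_sq (by positivity)]
      field_simp; ring
  have hinj : Set.InjOn φ Set.univ := by
    intro u _ v _ h
    rw [← hφu u, ← hφu v, h]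
  set ψ : ℝ → ℝ := fun u => (1 + u / Real.sqrt (u^2 + 4*(a*b))) / (2*a) with hψ
  have hder : ∀ u ∈ Set.univ, HasDerivWithinAt φ (ψ u) Set.univ u := by
    intro u _
    apply HasDerivAt.hasDerivWithinAt
    have h1 : HasDerivAt (fun u : ℝ => u^2 + 4*(a*b)) (2*u) u := by
      simpa using (hasDerivAt_pow 2 u).add_const (4*(a*b))
    have h2 := ((hasDerivAt_id u).add (h1.sqrt (hpos u).ne')).div_const (2*a)
    have e : ψ u = (1 + 2 * u / (2 * Real.sqrt (u^2 + 4*(a*b)))) / (2*a) := by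
      simp only [hψ]
      rw [mul_div_mul_left _ _ two_ne_zero]
    rw [e]
    exact h2
  have hratio : ∀ u : ℝ, |u / Real.sqrt (u^2 + 4*(a*b))| ≤ 1 := by
    intro u
    rw [abs_div, abs_of_pos (hsp u), div_le_one (hsp u)]
    exact (habs u).le
  have hψ0 : ∀ u, 0 ≤ ψ u := by
    intro u
    have := (abs_le.1 (hratio u)).1
    simp only [hψ]
    apply div_nonneg <;> linarith
  rw [← himg, integral_image_eq_integral_abs_deriv_smul MeasurableSet.univ hder hinj,
    Measure.restrict_univ]
  have hE : ∀ u, |ψ u| • Real.exp (-(a^2 * φ u^2) - b^2/φ u^2)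
      = Real.exp (-(2*a*b)) / (2*a) * (Real.exp (-1 * u^2)
        + u / Real.sqrt (u^2 + 4*(a*b)) * Real.exp (-1 * u^2)) := by
    intro u
    have h1 : -(a^2 * φ u^2) - b^2/φ u^2 = -(2*a*b) + -1 * u^2 := by
      have h0 := (hφpos u).ne'
      have : u^2 = (a * φ u - b / φ u)^2 := by rw [hφu u]
      rw [this]
      field_simp; ring
    rw [h1, Real.exp_add, abs_of_nonneg (hψ0 u)]
    simp only [hψ, smul_eq_mul]
    ring
  simp_rw [hE]
  have hi1 : Integrable (fun u : ℝ => Real.exp (-1 * u^2)) := integrable_exp_neg_mul_sq one_pos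
  have hi2 : Integrable (fun u : ℝ => u / Real.sqrt (u^2 + 4*(a*b)) * Real.exp (-1 * u^2)) := by
    apply hi1.bdd_mul (c := 1)
    · apply Measurable.aestronglyMeasurable
      fun_prop
    · exact Filter.Eventually.of_forall hratio
  have hodd : ∫ u : ℝ, u / Real.sqrt (u^2 + 4*(a*b)) * Real.exp (-1 * u^2) = 0 := by
    have h := integral_neg_eq_self (fun u : ℝ => u / Real.sqrt (u^2 + 4*(a*b)) * Real.exp (-1 * u^2)) volume
    simp only [neg_sq, neg_div, neg_mul] at h
    rw [integral_neg] at h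
    simp only [neg_mul]
    linarith
  rw [integral_const_mul, integral_add hi1 hi2, hodd, integral_gaussian]
  simp only [div_one, add_zero]
  ring

lemma aux_line (a b : ℝ) (ha : 0 < a) (hb : 0 ≤ b) :
    ∫ x : ℝ, Real.exp (-(a^2*x^2) - b^2/x^2)
      = Real.sqrt Real.pi / a * Real.exp (-(2*a*b)) := by
  rcases hb.eq_or_lt with rfl | hb
  · have := integral_gaussian (a^2)
    simp only [neg_mul] at this
    simp [this, Real.sqrt_div Real.pi_pos.le, Real.sqrt_sq ha.le]
  · have h := integral_comp_abs (f := fun x : ℝ => Real.exp (-(a^2*x^2) - b^2/x^2))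
    simp only [sq_abs] at h
    rw [h, aux_glasser a b ha hb]
    field_simp

lemma aux_pt (g q p c s : ℝ) (hg : 0 < g) (hq : q ≠ 0) (hcs : s^2 + c^2 = 1) :
    - q ^ 2 - p ^ 2 + g ^ 2 / ((q * c + p * s) ^ 2 + 2 * g ^ 2 * s ^ 2 / q ^ 2) - g ^ 2 / q ^ 2
      ≤ -(q^2 + p^2 + (q*c+p*s)^2)/2 - (g*|s|)^2/q^2 := by
  have hZ : 0 < (q * c + p * s) ^ 2 + 2 * g ^ 2 * s ^ 2 / q ^ 2 := by
    by_cases hs : s = 0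
    · subst hs
      have : c ≠ 0 := by rintro rfl; norm_num at hcs
      have : 0 < (q * c)^2 := by positivity
      simpa using this
    · positivity
  have e : (g*|s|)^2/q^2 = (2 * g ^ 2 * s ^ 2 / q ^ 2)/2 := by
    rw [mul_pow, sq_abs]; ring
  rw [e]
  have key : ((q*c+p*s)*(p*c-q*s) + 2*g^2*s*c/q^2)^2
     = ((q * c + p * s) ^ 2 + 2 * g ^ 2 * s ^ 2 / q ^ 2) * (q^2+p^2+2*g^2/q^2)
       - ((q * c + p * s) ^ 2 + 2 * g ^ 2 * s ^ 2 / q ^ 2)^2 - 2*g^2 := by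
    have hc : c^2 = 1 - s^2 := by linarith
    have hc3 : c^3 = c*(1 - s^2) := by rw [← hc]; ring
    have hc4 : c^4 = (1 - s^2)^2 := by rw [← hc]; ring
    field_simp
    ring_nf
    simp only [hc, hc3, hc4]
    ring
  have k0 := sq_nonneg ((q*c+p*s)*(p*c-q*s) + 2*g^2*s*c/q^2)
  rw [key] at k0
  set Z := (q * c + p * s) ^ 2 + 2 * g ^ 2 * s ^ 2 / q ^ 2 with hZd
  have : g^2 / Z ≤ (q^2+p^2+2*g^2/q^2 - Z)/2 := by
    rw [div_le_iff₀ hZ]; nlinarith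
  have e2 : 2*g^2/q^2 = 2*(g^2/q^2) := by ring
  rw [e2] at this
  linarith

lemma aux_plane (g c s : ℝ) (hg : 0 < g) (hcs : s^2 + c^2 = 1) :
    Integrable (fun x : ℝ × ℝ =>
      Real.exp (-(x.1^2 + x.2^2 + (x.1*c+x.2*s)^2)/2 - (g*|s|)^2/x.1^2)) ∧
    ∫ x : ℝ × ℝ, Real.exp (-(x.1^2 + x.2^2 + (x.1*c+x.2*s)^2)/2 - (g*|s|)^2/x.1^2)
      = Real.pi * (Real.sqrt 2 * Real.exp (-(2*(g*|s|/Real.sqrt (1+s^2))))) := by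
  have hint : Integrable (fun x : ℝ × ℝ =>
      Real.exp (-(x.1^2 + x.2^2 + (x.1*c+x.2*s)^2)/2 - (g*|s|)^2/x.1^2)) := by
    have h1 : Integrable (fun u : ℝ => Real.exp (-(1/2) * u^2)) :=
      integrable_exp_neg_mul_sq (by norm_num)
    refine (h1.mul_prod h1).mono' ?_ ?_
    · apply Measurable.aestronglyMeasurable
      fun_prop
    · refine Filter.Eventually.of_forall fun x => ?_
      rw [Real.norm_eq_abs, Real.abs_exp, ← Real.exp_add, Real.exp_le_exp]
      have : 0 ≤ (g*|s|)^2/x.1^2 := by positivity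
      nlinarith [sq_nonneg (x.1*c+x.2*s)]
  refine ⟨hint, ?_⟩
  rw [Measure.volume_eq_prod] at hint ⊢
  rw [integral_prod _ hint]
  have hd : 0 < 1 + s^2 := by positivity
  have hr : 0 < Real.sqrt (1+s^2) := Real.sqrt_pos.2 hd
  have hr2 : Real.sqrt (1+s^2)^2 = 1+s^2 := Real.sq_sqrt hd.le
  have hinner : ∀ q : ℝ, ∫ p : ℝ, Real.exp (-(q^2 + p^2 + (q*c+p*s)^2)/2 - (g*|s|)^2/q^2)
      = Real.exp (-((1/Real.sqrt (1+s^2))^2*q^2) - (g*|s|)^2/q^2)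
        * Real.sqrt (Real.pi / ((1+s^2)/2)) := by
    intro q
    rw [← integral_gaussian, ← integral_const_mul,
      ← integral_add_right_eq_self (fun p : ℝ => _ * Real.exp (-((1+s^2)/2) * p^2)) (q*c*s/(1+s^2))]
    congr 1
    ext p
    rw [← Real.exp_add]
    congr 1
    rw [div_pow, hr2]
    have hc : c^2 = 1 - s^2 := by linarith
    have : -(q^2 + p^2 + (q*c+p*s)^2)/2 = -(1 ^ 2 / (1 + s ^ 2) * q ^ 2) + -((1 + s ^ 2) / 2) * (p + q * c * s / (1 + s ^ 2)) ^ 2 := by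
      field_simp
      ring_nf
      simp only [hc]
      ring
    rw [this]; ring
  simp only [hinner]
  rw [integral_mul_const, aux_line _ _ (by positivity) (by positivity)]
  have e1 : Real.pi / ((1+s^2)/2) = Real.pi * 2 / (1+s^2) := by field_simp
  rw [e1, Real.sqrt_div (by positivity), Real.sqrt_mul Real.pi_pos.le]
  have e2 : 2 * (1 / Real.sqrt (1+s^2)) * (g*|s|) = 2*(g*|s|/Real.sqrt (1+s^2)) := by ring
  rw [e2]
  have hpi := Real.mul_self_sqrt Real.pi_pos.le
  field_simp
  nlinarith

/-- Proposition 4.3(i), upper bound: the Gaussian classical fidelity for the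
perturbed harmonic oscillator satisfies
`F_C(t,g) ≤ √2 exp(-g |sin t| / √(1 + sin²t))`. -/
theorem classical_fidelity_HO_upper_bound (g : ℝ) (hg : 0 < g) (t : ℝ) :
    (1 / Real.pi) * (∫ x : ℝ × ℝ,
        (if x.1 = 0 then 0 else
          Real.exp (- x.1 ^ 2 - x.2 ^ 2
            + g ^ 2 / ((x.1 * Real.cos t + x.2 * Real.sin t) ^ 2
                + 2 * g ^ 2 * (Real.sin t) ^ 2 / x.1 ^ 2)
            - g ^ 2 / x.1 ^ 2)))
      ≤ Real.sqrt 2 * Real.exp (- g * |Real.sin t| / Real.sqrt (1 + (Real.sin t) ^ 2)) := by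
  have hcs := Real.sin_sq_add_cos_sq t
  obtain ⟨hI, hE⟩ := aux_plane g (Real.cos t) (Real.sin t) hg hcs
  have hle := integral_mono_of_nonneg (μ := volume) (f := fun x : ℝ × ℝ =>
        (if x.1 = 0 then 0 else
          Real.exp (- x.1 ^ 2 - x.2 ^ 2
            + g ^ 2 / ((x.1 * Real.cos t + x.2 * Real.sin t) ^ 2
                + 2 * g ^ 2 * (Real.sin t) ^ 2 / x.1 ^ 2)
            - g ^ 2 / x.1 ^ 2))) (Filter.Eventually.of_forall fun x => by
              dsimp only
              split_ifs
              · exact le_rfl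
              · exact (Real.exp_pos _).le) hI (Filter.Eventually.of_forall fun x => by
              dsimp only
              split_ifs with h
              · exact (Real.exp_pos _).le
              · exact Real.exp_le_exp.2 (aux_pt g x.1 x.2 _ _ hg h hcs))
  rw [hE] at hle
  rw [one_div, inv_mul_le_iff₀ Real.pi_pos]
  refine hle.trans ?_
  have : 0 ≤ g * |Real.sin t| / Real.sqrt (1 + (Real.sin t) ^ 2) := by positivity
  have e : - g * |Real.sin t| / Real.sqrt (1 + (Real.sin t) ^ 2)
    = -(g * |Real.sin t| / Real.sqrt (1 + (Real.sin t) ^ 2)) := by ring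
  rw [e]
  have := Real.pi_pos
  gcongr
  linarith
end

section
/- Let g ≥ 1/√2 and define F̃_C(π/2, g) := (1/π) · vol{(q,p) ∈ ℝ² : q ≠ 0, q² + p² ≤ 1, and q² + p² + 2g²/q² - 2g²/(p² + 2g²/q²) ≤ 1}, where vol denotes two-dimensional Lebesgue measure. Then F̃_C(π/2, g) = 0. -/
open MeasureTheory

/-- Proposition 4.3(iii): for `g ≥ 1/√2` the characteristic-function classical
fidelity at `t = π/2` vanishes. -/
theorem classical_fidelity_HO_char_vanishes (g : ℝ) (hg : 1 / Real.sqrt 2 ≤ g) :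
    (1 / Real.pi) * (volume {x : ℝ × ℝ | x.1 ≠ 0 ∧ x.1 ^ 2 + x.2 ^ 2 ≤ 1 ∧
      x.1 ^ 2 + x.2 ^ 2 + 2 * g ^ 2 / x.1 ^ 2
        - 2 * g ^ 2 / (x.2 ^ 2 + 2 * g ^ 2 / x.1 ^ 2) ≤ 1}).toReal = 0 := by
  have hc : 1 ≤ 2 * g ^ 2 := by
    have h2 : (0 : ℝ) < Real.sqrt 2 := by positivity
    have h3 := Real.sq_sqrt (show (0 : ℝ) ≤ 2 by norm_num)
    rw [div_le_iff₀ h2] at hg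
    have h4 : 1 ≤ (g * Real.sqrt 2) ^ 2 := by nlinarith
    rw [mul_pow, h3] at h4
    linarith
  generalize 2 * g ^ 2 = c at hc
  have hsub : {x : ℝ × ℝ | x.1 ≠ 0 ∧ x.1 ^ 2 + x.2 ^ 2 ≤ 1 ∧
      x.1 ^ 2 + x.2 ^ 2 + c / x.1 ^ 2
        - c / (x.2 ^ 2 + c / x.1 ^ 2) ≤ 1} ⊆ ({(1, 0), (-1, 0)} : Set (ℝ × ℝ)) := by
    rintro ⟨q, p⟩ ⟨hq, h1, h2⟩
    simp only at hq h1 h2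
    have ha : 0 < q ^ 2 := by positivity
    have hb : 0 ≤ p ^ 2 := sq_nonneg p
    have hca : 0 < c / q ^ 2 := by positivity
    have hY : c / (p ^ 2 + c / q ^ 2) ≤ q ^ 2 := by
      rw [div_le_iff₀ (by positivity), mul_add, mul_div_cancel₀ _ ha.ne']
      nlinarith [mul_nonneg ha.le hb]
    have h3 : c / q ^ 2 ≤ 1 := by linarith
    rw [div_le_one ha] at h3
    have hp : p = 0 := by
      have : p ^ 2 = 0 := by linarith
      exact pow_eq_zero_iff two_ne_zero |>.mp this
    have hq1 : q ^ 2 = 1 := by linarith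
    rcases (sq_eq_sq_iff_eq_or_eq_neg (b := (1:ℝ))).mp (by rw [hq1, one_pow]) with h | h <;> simp [h, hp]
  have hz := measure_mono_null hsub
    ((Set.toFinite ({(1, 0), (-1, 0)} : Set (ℝ × ℝ))).measure_zero volume)
  rw [hz]
  simp
end
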